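/- Let a, b ∈ ℝ with a ≠ 0, and for y ≠ 0 define G(y) = ½Φ(y) + ½Φ(a/√(1+b²)) − ½·1{ a/(y√(1+b²)) < 0 } − T(y, (a + b y)/y) − T(a/√(1+b²), (ab + y(1+b²))/a). Then G(y) → 0 as y → −∞, where T is Owen's T function. -/

import Mathlib

open Real MeasureTheory Filter Topology

/-- Standard normal density. -/
noncomputable def stdNormalPdf (x : ℝ) : ℝ := Real.exp (-x ^ 2 / 2) / Real.sqrt (2 * Real.pi)

/-- Standard normal cumulative distribution function. -/
noncomputable def stdNormalCdf (x : ℝ) : ℝ := ∫ t in Set.Iic x, stdNormalPdf t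

/-- Owen's T function. -/
noncomputable def owenT (h g : ℝ) : ℝ :=
  (1 / (2 * Real.pi)) * ∫ t in (0:ℝ)..g, Real.exp (-h ^ 2 * (1 + t ^ 2) / 2) / (1 + t ^ 2)


lemma stdNormalPdf_eq_gaussianPDFReal : stdNormalPdf = ProbabilityTheory.gaussianPDFReal 0 1 := by
  ext x
  simp [stdNormalPdf, ProbabilityTheory.gaussianPDFReal, div_eq_inv_mul]

lemma integrable_stdNormalPdf : Integrable stdNormalPdf :=
  stdNormalPdf_eq_gaussianPDFReal ▸ ProbabilityTheory.integrable_gaussianPDFReal 0 1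

lemma stdNormalCdf_eq_one_sub (x : ℝ) :
    stdNormalCdf x = 1 - ∫ t in Set.Ioi x, stdNormalPdf t := by
  have h1 : ∫ t, stdNormalPdf t = 1 := by
    rw [stdNormalPdf_eq_gaussianPDFReal]
    exact ProbabilityTheory.integral_gaussianPDFReal_eq_one 0 one_ne_zero
  have h2 := integral_add_compl (measurableSet_Iic (a := x)) integrable_stdNormalPdf
  rw [Set.compl_Iic, h1] at h2
  rw [stdNormalCdf]
  linarith

lemma stdNormalCdf_neg (x : ℝ) : stdNormalCdf (-x) = 1 - stdNormalCdf x := by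
  have h : stdNormalCdf (-x) = ∫ t in Set.Ioi x, stdNormalPdf t := by
    rw [stdNormalCdf, ← neg_neg x, ← integral_comp_neg_Iic, neg_neg]
    simp [stdNormalPdf]
  rw [h, stdNormalCdf_eq_one_sub x]
  ring

lemma tendsto_stdNormalCdf_atBot : Tendsto stdNormalCdf atBot (𝓝 0) := by
  have h : stdNormalCdf = ProbabilityTheory.cdf (ProbabilityTheory.gaussianReal 0 1) := by
    ext x
    rw [ProbabilityTheory.cdf_eq_real, measureReal_def,
      ProbabilityTheory.gaussianReal_apply_eq_integral 0 one_ne_zero, ENNReal.toReal_ofReal,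
      stdNormalCdf, stdNormalPdf_eq_gaussianPDFReal]
    exact integral_nonneg fun t => ProbabilityTheory.gaussianPDFReal_nonneg 0 1 t
  rw [h]
  exact ProbabilityTheory.tendsto_cdf_atBot _

lemma owenT_neg_left (h g : ℝ) : owenT (-h) g = owenT h g := by
  simp [owenT]

lemma owenT_neg_right (h g : ℝ) : owenT h (-g) = -owenT h g := by
  have := intervalIntegral.integral_comp_neg (a := 0) (b := g)
    (fun t : ℝ => Real.exp (-h ^ 2 * (1 + t ^ 2) / 2) / (1 + t ^ 2))
  simp only [neg_sq, neg_zero] at this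
  rw [owenT, owenT, intervalIntegral.integral_symm, ← this]
  ring

lemma abs_owenT_le (h g : ℝ) :
    |owenT h g| ≤ 1 / (2 * Real.pi) * (Real.exp (-h ^ 2 / 2) * |g|) := by
  rw [owenT, abs_mul, abs_of_pos (by positivity : 0 < 1 / (2 * Real.pi))]
  gcongr
  have := intervalIntegral.norm_integral_le_of_norm_le_const (a := 0) (b := g)
    (C := Real.exp (-h ^ 2 / 2))
    (f := fun t : ℝ => Real.exp (-h ^ 2 * (1 + t ^ 2) / 2) / (1 + t ^ 2)) fun t _ => by
      rw [Real.norm_of_nonneg (by positivity)]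
      refine (div_le_self (by positivity) (by nlinarith [sq_nonneg t])).trans ?_
      exact Real.exp_le_exp.2 (by nlinarith [mul_nonneg (sq_nonneg h) (sq_nonneg t)])
  simpa using this

lemma integrable_exp_neg_sq_mul_div (h : ℝ) :
    Integrable fun t : ℝ => Real.exp (-h ^ 2 * (1 + t ^ 2) / 2) / (1 + t ^ 2) := by
  refine integrable_inv_one_add_sq.mono' ?_ (ae_of_all _ fun t => ?_)
  · exact Measurable.aestronglyMeasurable (by fun_prop)
  · rw [Real.norm_of_nonneg (by positivity), div_eq_mul_inv]
    refine mul_le_of_le_one_left (by positivity) (Real.exp_le_one_iff.2 ?_)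
    nlinarith [mul_nonneg (sq_nonneg h) (sq_nonneg t), sq_nonneg h]

lemma integral_Ioi_mul_exp_neg_mul_sq {c : ℝ} (hc : 0 < c) (h : ℝ) :
    ∫ s in Set.Ioi h, s * Real.exp (-s ^ 2 * c / 2) = Real.exp (-h ^ 2 * c / 2) / c := by
  have hd (s : ℝ) : HasDerivAt (fun s => -(Real.exp (-s ^ 2 * c / 2) / c))
      (s * Real.exp (-s ^ 2 * c / 2)) s := by
    have := ((((((hasDerivAt_id s).pow 2).neg).mul_const c).div_const 2).exp.div_const c).neg
    refine HasDerivAt.congr_deriv this ?_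
    simp
    field_simp
  have hint : Integrable fun s : ℝ => s * Real.exp (-s ^ 2 * c / 2) := by
    convert integrable_mul_exp_neg_mul_sq (half_pos hc) using 4
    ring
  have hlim : Tendsto (fun s : ℝ => -(Real.exp (-s ^ 2 * c / 2) / c)) atTop (𝓝 0) := by
    have h1 : Tendsto (fun s : ℝ => -s ^ 2 * c / 2) atTop atBot := by
      have := tendsto_neg_atTop_atBot.comp
        ((tendsto_pow_atTop (α := ℝ) two_ne_zero).atTop_mul_const (half_pos hc))
      refine this.congr fun s => ?_
      simp only [Function.comp]
      ring
    simpa using ((Real.tendsto_exp_atBot.comp h1).div_const c).neg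
  rw [integral_Ioi_of_hasDerivAt_of_tendsto' (fun s _ => hd s) hint.integrableOn hlim]
  ring

lemma integral_Ioi_mul_exp_neg_sq_mul {s : ℝ} (hs : 0 < s) :
    ∫ t in Set.Ioi (0 : ℝ), s * Real.exp (-s ^ 2 * (1 + t ^ 2) / 2) =
      Real.pi * stdNormalPdf s := by
  have h1 (t : ℝ) : s * Real.exp (-s ^ 2 * (1 + t ^ 2) / 2) =
      s * Real.exp (-s ^ 2 / 2) * Real.exp (-(s ^ 2 / 2) * t ^ 2) := by
    rw [mul_assoc, ← Real.exp_add]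
    ring_nf
  have h2 : Real.sqrt (Real.pi / (s ^ 2 / 2)) = Real.sqrt (2 * Real.pi) / s := by
    rw [show Real.pi / (s ^ 2 / 2) = 2 * Real.pi / s ^ 2 by field_simp,
      Real.sqrt_div (by positivity), Real.sqrt_sq hs.le]
  have h3 : Real.sqrt (2 * Real.pi) ^ 2 = 2 * Real.pi := Real.sq_sqrt (by positivity)
  simp only [h1]
  rw [integral_const_mul, integral_gaussian_Ioi, h2, stdNormalPdf]
  field_simp
  rw [h3]

lemma integral_Ioi_exp_neg_sq_mul_div {h : ℝ} (hh : 0 < h) :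
    ∫ t in Set.Ioi (0 : ℝ), Real.exp (-h ^ 2 * (1 + t ^ 2) / 2) / (1 + t ^ 2) =
      Real.pi * (1 - stdNormalCdf h) := by
  have hint : Integrable
      (Function.uncurry fun t s : ℝ => s * Real.exp (-s ^ 2 * (1 + t ^ 2) / 2))
      ((volume.restrict (Set.Ioi 0)).prod (volume.restrict (Set.Ioi h))) := by
    refine (integrable_prod_iff' (Measurable.aestronglyMeasurable (by fun_prop))).2 ⟨?_, ?_⟩
    · filter_upwards [ae_restrict_mem measurableSet_Ioi] with s hs
      have hs0 : 0 < s := hh.trans hs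
      have := (integrable_exp_neg_mul_sq (b := s ^ 2 / 2) (by positivity)).const_mul
        (s * Real.exp (-s ^ 2 / 2))
      refine this.integrableOn.congr (ae_of_all _ fun t => ?_)
      simp only [Function.uncurry]
      rw [mul_assoc, ← Real.exp_add]
      ring_nf
    · refine (integrable_stdNormalPdf.integrableOn.const_mul Real.pi).congr ?_
      filter_upwards [ae_restrict_mem measurableSet_Ioi] with s hs
      have hs0 : 0 < s := hh.trans hs
      rw [← integral_Ioi_mul_exp_neg_sq_mul hs0]
      refine integral_congr_ae (ae_of_all _ fun t => ?_)
      exact (Real.norm_of_nonneg (by positivity)).symm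
  calc ∫ t in Set.Ioi (0 : ℝ), Real.exp (-h ^ 2 * (1 + t ^ 2) / 2) / (1 + t ^ 2)
      = ∫ t in Set.Ioi (0 : ℝ), ∫ s in Set.Ioi h, s * Real.exp (-s ^ 2 * (1 + t ^ 2) / 2) := by
        refine integral_congr_ae (ae_of_all _ fun t => ?_)
        exact (integral_Ioi_mul_exp_neg_mul_sq (by positivity) h).symm
    _ = ∫ s in Set.Ioi h, ∫ t in Set.Ioi (0 : ℝ), s * Real.exp (-s ^ 2 * (1 + t ^ 2) / 2) :=
        integral_integral_swap hint
    _ = ∫ s in Set.Ioi h, Real.pi * stdNormalPdf s :=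
        setIntegral_congr_fun measurableSet_Ioi fun s hs =>
          integral_Ioi_mul_exp_neg_sq_mul (hh.trans hs)
    _ = Real.pi * (1 - stdNormalCdf h) := by
        rw [integral_const_mul, stdNormalCdf_eq_one_sub]
        ring

lemma tendsto_owenT_atTop {h : ℝ} (hh : 0 < h) :
    Tendsto (owenT h) atTop (𝓝 ((1 - stdNormalCdf h) / 2)) := by
  have := (intervalIntegral_tendsto_integral_Ioi 0
    (integrable_exp_neg_sq_mul_div h).integrableOn tendsto_id).const_mul (1 / (2 * Real.pi))
  rw [integral_Ioi_exp_neg_sq_mul_div hh] at this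
  rw [show 1 / (2 * Real.pi) * (Real.pi * (1 - stdNormalCdf h)) = (1 - stdNormalCdf h) / 2 by
    field_simp] at this
  exact this

lemma tendsto_owenT_add_mul_div_atBot (a b : ℝ) :
    Tendsto (fun y => owenT y ((a + b * y) / y)) atBot (𝓝 0) := by
  have hg : Tendsto (fun y : ℝ => (a + b * y) / y) atBot (𝓝 b) := by
    have : Tendsto (fun y : ℝ => a / y + b) atBot (𝓝 (0 + b)) :=
      (tendsto_id.const_div_atBot a).add_const b
    rw [zero_add] at this
    refine this.congr' ?_
    filter_upwards [eventually_lt_atBot 0] with y hy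
    field_simp [hy.ne]
  have he : Tendsto (fun y : ℝ => Real.exp (-y ^ 2 / 2)) atBot (𝓝 0) := by
    have h1 : Tendsto (fun y : ℝ => y ^ 2 / 2) atBot atTop :=
      ((tendsto_pow_atTop two_ne_zero).comp tendsto_abs_atBot_atTop).atTop_div_const two_pos |>.congr
        fun y => by simp
    refine (Real.tendsto_exp_neg_atTop_nhds_zero.comp h1).congr fun y => ?_
    simp [neg_div]
  refine squeeze_zero_norm (fun y => abs_owenT_le _ _) ?_
  simpa using (he.mul hg.abs).const_mul (1 / (2 * Real.pi))

theorem stmt13 (a b : ℝ) (ha : a ≠ 0)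
    (G : ℝ → ℝ)
    (hG : ∀ y : ℝ, y ≠ 0 → G y =
      (1 / 2) * stdNormalCdf y + (1 / 2) * stdNormalCdf (a / Real.sqrt (1 + b ^ 2))
        - (1 / 2) * (if a / (y * Real.sqrt (1 + b ^ 2)) < 0 then 1 else 0)
        - owenT y ((a + b * y) / y)
        - owenT (a / Real.sqrt (1 + b ^ 2)) ((a * b + y * (1 + b ^ 2)) / a)) :
    Tendsto G atBot (𝓝 0) := by
  have hr : 0 < Real.sqrt (1 + b ^ 2) := by positivity
  set r := Real.sqrt (1 + b ^ 2)
  have hlin : Tendsto (fun y : ℝ => a * b + y * (1 + b ^ 2)) atBot atBot :=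
    tendsto_atBot_add_const_left _ _ (tendsto_id.atBot_mul_const (by positivity))
  have hmain := ((tendsto_stdNormalCdf_atBot.const_mul (1 / 2)).sub
    (tendsto_owenT_add_mul_div_atBot a b))
  rcases ha.lt_or_gt with ha | ha
  · have hT := (tendsto_owenT_atTop (div_pos (neg_pos.2 ha) hr)).comp
      (hlin.atBot_mul_const_of_neg (inv_lt_zero.2 ha))
    have := (hmain.add_const (1 / 2 * stdNormalCdf (a / r))).sub hT
    rw [neg_div, stdNormalCdf_neg] at this
    convert this.congr' ?_ using 2
    · ring
    filter_upwards [eventually_lt_atBot 0] with y hy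
    rw [hG y hy.ne, if_neg (div_pos_of_neg_of_neg ha (mul_neg_of_neg_of_pos hy hr)).not_gt]
    simp only [Function.comp, owenT_neg_left, div_eq_mul_inv]
    ring
  · have hT := (tendsto_owenT_atTop (div_pos ha hr)).comp
      (tendsto_neg_atBot_atTop.comp (hlin.atBot_mul_const (inv_pos.2 ha)))
    have := (hmain.add_const (1 / 2 * stdNormalCdf (a / r) - 1 / 2)).add hT
    convert this.congr' ?_ using 2
    · ring
    filter_upwards [eventually_lt_atBot 0] with y hy
    rw [hG y hy.ne, if_pos (div_neg_of_pos_of_neg ha (mul_neg_of_neg_of_pos hy hr))]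
    simp only [Function.comp, owenT_neg_right, div_eq_mul_inv]
    ring
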